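/- Let N be a network whose bulged version B(N) has a cherry cover P, and let A be a lowest shape of P (a shape of P that is above no other shape of P) with endpoints x and y, where the edge p_y y of A has tail p_y a tree vertex. Then x and y are leaves of N and (x,y) is a reducible pair in N. -/

import Mathlib

open scoped Classical

noncomputable section

namespace PhyloNet

/-- A directed multigraph on vertex set `ℕ`, given by its multiset of arcs.
Phylogenetic networks are the simple such graphs satisfying `IsNetwork`;
bulged versions are genuinely multigraphs. -/
abbrev Graph := Multiset (ℕ × ℕ)

/-- The vertices of a multigraph: all endpoints of arcs. -/
def verts (M : Graph) : Finset ℕ :=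
  M.toFinset.image Prod.fst ∪ M.toFinset.image Prod.snd

/-- Indegree of a vertex (counting parallel arcs with multiplicity). -/
def indeg (M : Graph) (v : ℕ) : ℕ := Multiset.card (M.filter (fun e => e.2 = v))

/-- Outdegree of a vertex (counting parallel arcs with multiplicity). -/
def outdeg (M : Graph) (v : ℕ) : ℕ := Multiset.card (M.filter (fun e => e.1 = v))

def adj (M : Graph) (u v : ℕ) : Prop := (u, v) ∈ M

/-- A multigraph is acyclic if no vertex reaches itself by a nonempty directed walk. -/
def Acyclic (M : Graph) : Prop := ∀ v : ℕ, ¬ Relation.TransGen (adj M) v v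

/-- No parallel arcs. -/
def Simple (M : Graph) : Prop := ∀ e : ℕ × ℕ, M.count e ≤ 1

/-- The root: the unique vertex of indegree 0 and outdegree 1. -/
def IsRoot (M : Graph) (v : ℕ) : Prop := v ∈ verts M ∧ indeg M v = 0 ∧ outdeg M v = 1

/-- A leaf: a vertex of indegree 1 and outdegree 0. -/
def IsLeaf (M : Graph) (v : ℕ) : Prop := v ∈ verts M ∧ indeg M v = 1 ∧ outdeg M v = 0

/-- A tree vertex: indegree 1 and outdegree at least 2. -/
def IsTreeVertex (M : Graph) (v : ℕ) : Prop := v ∈ verts M ∧ indeg M v = 1 ∧ 2 ≤ outdeg M v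

/-- A reticulation: indegree at least 2 and outdegree 1. -/
def IsRetic (M : Graph) (v : ℕ) : Prop := v ∈ verts M ∧ 2 ≤ indeg M v ∧ outdeg M v = 1

/-- A (phylogenetic) network: a simple DAG with a unique root (indegree 0, outdegree 1),
in which every other vertex is a leaf (indegree 1, outdegree 0), a tree vertex
(indegree 1, outdegree ≥ 2) or a reticulation (indegree ≥ 2, outdegree 1).
The leaves are regarded as labelled by themselves (the label set is the leaf set). -/
def IsNetwork (M : Graph) : Prop :=
  Simple M ∧ Acyclic M ∧ (∃! v, IsRoot M v) ∧
    ∀ v ∈ verts M, IsRoot M v ∨ IsLeaf M v ∨ IsTreeVertex M v ∨ IsRetic M v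

/-- The set of leaves of a multigraph. -/
def leaves (M : Graph) : Finset ℕ :=
  (verts M).filter (fun v => indeg M v = 1 ∧ outdeg M v = 0)

/-- A network is a tree when it has no reticulations. -/
def IsTree (M : Graph) : Prop := IsNetwork M ∧ ∀ v : ℕ, ¬ IsRetic M v

/-- Binary: all vertices have total degree at most 3. -/
def IsBinary (M : Graph) : Prop := ∀ v ∈ verts M, indeg M v + outdeg M v ≤ 3

/-- Semi-binary: all tree vertices have total degree at most 3. -/
def IsSemiBinary (M : Graph) : Prop :=
  ∀ v : ℕ, IsTreeVertex M v → indeg M v + outdeg M v ≤ 3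

/-- The reticulation number: total number of incoming arcs of reticulations minus
the number of reticulations. -/
def reticNumber (M : Graph) : ℕ :=
  ∑ v ∈ (verts M).filter (fun v => 2 ≤ indeg M v), (indeg M v - 1)

/-- The bulged version `B(N)`: replace the outgoing edge of each reticulation of
indegree `k` by `k-1` parallel copies. -/
def bulged (M : Graph) : Graph :=
  M.bind (fun e =>
    Multiset.replicate
      (if 2 ≤ indeg M e.1 ∧ outdeg M e.1 = 1 then indeg M e.1 - 1 else 1) e)

/-- A cherry shape (on distinct vertices `x,y,p` with edges `px, py`) or a
reticulated cherry shape (on distinct vertices `x,y,p_x,p_y` with edges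
`p_x x, p_y p_x, p_y y`, `p_x` a reticulation). -/
inductive Shape : Type where
  | cherry (x y p : ℕ) : Shape
  | retic (x y px py : ℕ) : Shape
deriving DecidableEq

namespace Shape

/-- The edges of a shape. -/
def edges : Shape → Finset (ℕ × ℕ)
  | cherry x y p => {(p, x), (p, y)}
  | retic x y px py => {(px, x), (py, px), (py, y)}

/-- The endpoints of a shape. -/
def endpoints : Shape → Finset ℕ
  | cherry x y _ => {x, y}
  | retic x y _ _ => {x, y}

/-- The internal vertices of a shape. -/
def internals : Shape → Finset ℕ
  | cherry _ _ p => {p}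
  | retic _ _ px py => {px, py}

/-- The middle edge of a reticulated cherry shape. -/
def middleEdge : Shape → Option (ℕ × ℕ)
  | cherry _ _ _ => none
  | retic _ _ px py => some (py, px)

def isCherry : Shape → Bool
  | cherry _ _ _ => true
  | retic _ _ _ _ => false

/-- Validity of a shape as a subgraph of the multigraph `M`: the vertices are
distinct, the edges are present, and the internal reticulation of a reticulated
cherry shape is a reticulation of `M` (indegree ≥ 2 and outdegree ≥ 1). -/
def valid (M : Graph) : Shape → Prop
  | cherry x y p => x ≠ y ∧ x ≠ p ∧ y ≠ p ∧ (p, x) ∈ M ∧ (p, y) ∈ M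
  | retic x y px py =>
      x ≠ y ∧ x ≠ px ∧ x ≠ py ∧ y ≠ px ∧ y ≠ py ∧ px ≠ py ∧
      (px, x) ∈ M ∧ (py, px) ∈ M ∧ (py, y) ∈ M ∧
      2 ≤ indeg M px ∧ 1 ≤ outdeg M px

end Shape

/-- The number of shapes of `P` covering the arc `e`. -/
def covers (P : Finset Shape) (e : ℕ × ℕ) : ℕ :=
  (P.filter (fun A => e ∈ A.edges)).card

/-- A cherry cover of the multigraph `M` with root `r`: a set of valid shapes such
that every arc except the root arc is covered at least once, every outgoing arc of
a reticulation is covered exactly once (so, counted over parallel copies, exactly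
as often as its multiplicity), and every arc covered as the middle edge of a
reticulated cherry shape is covered exactly once. -/
def IsCherryCover (M : Graph) (r : ℕ) (P : Finset Shape) : Prop :=
  (∀ A ∈ P, A.valid M) ∧
  (∀ e ∈ M, e.1 ≠ r → 1 ≤ covers P e) ∧
  (∀ e ∈ M, (2 ≤ indeg M e.1 ∧ 1 ≤ outdeg M e.1) → covers P e = M.count e) ∧
  (∀ e : ℕ × ℕ, (∃ A ∈ P, A.middleEdge = some e) → covers P e = 1)

/-- A cherry decomposition of `M` with root `r`: a set of valid shapes covering
each arc except the root arc exactly once (over parallel copies, exactly as often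
as its multiplicity). -/
def IsCherryDecomp (M : Graph) (r : ℕ) (P : Finset Shape) : Prop :=
  (∀ A ∈ P, A.valid M) ∧
  (∀ e ∈ M, e.1 ≠ r → covers P e = M.count e)

/-- `A` is directly above `B` when an internal vertex of `B` is an endpoint of `A`. -/
def DirectlyAbove (A B : Shape) : Prop := ∃ v ∈ B.internals, v ∈ A.endpoints

/-- `A` is above `B` (within `P`) when some nonempty chain of shapes of `P`, each
directly above the next, leads from `A` to `B`. -/
def Above (P : Finset Shape) : Shape → Shape → Prop :=
  Relation.TransGen (fun A B => A ∈ P ∧ B ∈ P ∧ DirectlyAbove A B)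

/-- A cherry cover is acyclic when no shape is above itself. -/
def AcyclicCover (P : Finset Shape) : Prop := ∀ A : Shape, ¬ Above P A A

/-- A lowest shape of `P`: one that is above no other shape of `P`. -/
def IsLowest (P : Finset Shape) (A : Shape) : Prop :=
  A ∈ P ∧ ∀ B ∈ P, B ≠ A → ¬ Above P A B

/-- `E` is a spanning (directed) tree of `M` rooted at `r`: a subset of the arcs,
on all vertices of `M`, acyclic, in which `r` has indegree 0 and every other
vertex indegree exactly 1. -/
def IsSpanningArborescence (M : Graph) (r : ℕ) (E : Graph) : Prop :=
  E ≤ M ∧ verts E = verts M ∧ Acyclic E ∧ indeg E r = 0 ∧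
    ∀ v ∈ verts E, v ≠ r → indeg E v = 1

/-- `M` has a spanning tree whose leaves are (bijectively labelled by) `L`. -/
def HasSpanningTreeWithLeaves (M : Graph) (L : Finset ℕ) : Prop :=
  ∃ r E, IsRoot M r ∧ IsSpanningArborescence M r E ∧
    ∀ v ∈ verts E, (outdeg E v = 0 ↔ v ∈ L)

/-- A network is tree-based when it has a base tree, i.e. a spanning tree whose
leaves are exactly the (labelled) leaves of the network. -/
def IsTreeBased (M : Graph) : Prop := HasSpanningTreeWithLeaves M (leaves M)

/-- Rename the vertex `a` to `b` in an arc. -/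
def rn (a b : ℕ) (e : ℕ × ℕ) : ℕ × ℕ :=
  (if e.1 = a then b else e.1, if e.2 = a then b else e.2)

/-- The parent of a vertex (an arbitrary in-neighbour; unique for leaves). -/
def parent (M : Graph) (v : ℕ) : ℕ :=
  if h : ∃ p, (p, v) ∈ M then h.choose else 0

/-- `(x,y)` is a cherry: two distinct leaves with a common parent. -/
def IsCherryPair (M : Graph) (x y : ℕ) : Prop :=
  x ≠ y ∧ IsLeaf M x ∧ IsLeaf M y ∧ ∃ p, (p, x) ∈ M ∧ (p, y) ∈ M

/-- `(x,y)` is a reticulated cherry: leaves `x, y` such that the parent of `x` is a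
reticulation that is a child of the parent of `y`. -/
def IsReticCherryPair (M : Graph) (x y : ℕ) : Prop :=
  x ≠ y ∧ IsLeaf M x ∧ IsLeaf M y ∧
    ∃ px py, IsRetic M px ∧ (px, x) ∈ M ∧ (py, px) ∈ M ∧ (py, y) ∈ M

/-- A reducible pair: a cherry or a reticulated cherry. -/
def ReduciblePair (M : Graph) (x y : ℕ) : Prop :=
  IsCherryPair M x y ∨ IsReticCherryPair M x y

/-- Reducing the ordered pair `(x,y)` in the network `M`: delete the edges of the
corresponding cherry shape or reticulated cherry shape, delete isolated vertices,
label unlabelled outdegree-0 vertices by the label of one of their children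
(formally: rename them to that child), and keep the leaf `y` below its parent when
that parent is a multifurcation.  If `(x,y)` is not reducible, do nothing. -/
def reducePair (M : Graph) (xy : ℕ × ℕ) : Graph :=
  let x := xy.1
  let y := xy.2
  if IsCherryPair M x y then
    let p := parent M y
    if outdeg M p = 2 then ((M.erase (p, x)).erase (p, y)).map (rn p y)
    else M.erase (p, x)
  else if IsReticCherryPair M x y then
    let px := parent M x
    let py := parent M y
    let M₁ := M.erase (py, px)
    let M₂ := if indeg M px = 2 then (M₁.erase (px, x)).map (rn px x) else M₁
    if outdeg M py = 2 then (M₂.erase (py, y)).map (rn py y) else M₂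
  else M

/-- Successively reduce the ordered pairs of a sequence. -/
def reduceSeq (M : Graph) : List (ℕ × ℕ) → Graph
  | [] => M
  | e :: S => reduceSeq (reducePair M e) S

/-- Orchard: some sequence of ordered pairs reduces the network to a network on a
single leaf. -/
def IsOrchard (M : Graph) : Prop :=
  ∃ S : List (ℕ × ℕ),
    IsNetwork (reduceSeq M S) ∧ (leaves (reduceSeq M S)).card = 1

/-- One edge contraction: delete an arc and identify its endpoints. -/
def ContractStep (M M' : Graph) : Prop :=
  ∃ e ∈ M, M' = (M.erase e).map (rn e.1 e.2)

/-- `M` can be turned into `M'` by (repeatedly) contracting edges. -/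
def ContractsTo : Graph → Graph → Prop := Relation.ReflTransGen ContractStep

end PhyloNet

namespace PhyloNet

theorem aux_mem_bulged {N : Graph} {e : ℕ × ℕ} : e ∈ bulged N ↔ e ∈ N := by
  unfold bulged
  rw [Multiset.mem_bind]
  constructor
  · rintro ⟨a, ha, h⟩
    have := Multiset.eq_of_mem_replicate h
    rwa [this]
  · intro h
    refine ⟨e, h, ?_⟩
    rw [Multiset.mem_replicate]
    refine ⟨?_, rfl⟩
    split_ifs with h1
    · omega
    · omega

theorem aux_filter_bind (g : ℕ × ℕ → ℕ) (p : ℕ × ℕ → Prop) [DecidablePred p] (S : Multiset (ℕ × ℕ))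
    (h : ∀ e ∈ S, p e → g e = 1) :
    (S.bind (fun e => Multiset.replicate (g e) e)).filter p = S.filter p := by
  induction S using Multiset.induction_on with
  | empty => simp
  | cons a s ih =>
    rw [Multiset.cons_bind, Multiset.filter_add,
      ih (fun e he => h e (Multiset.mem_cons_of_mem he))]
    by_cases hp : p a
    · rw [h a (Multiset.mem_cons_self a s) hp, Multiset.filter_cons_of_pos _ hp]
      rw [Multiset.replicate_one, Multiset.filter_singleton, if_pos hp, Multiset.singleton_add]
    · rw [Multiset.filter_cons_of_neg _ hp]
      have : Multiset.filter p (Multiset.replicate (g a) a) = 0 := by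
        rw [Multiset.filter_eq_nil]
        intro b hb
        rwa [Multiset.eq_of_mem_replicate hb]
      rw [this, zero_add]

theorem aux_snd_mem {N : Graph} {u v : ℕ} (h : (u, v) ∈ N) : v ∈ verts N := by
  unfold verts
  simp only [Finset.mem_union, Finset.mem_image, Multiset.mem_toFinset]
  exact Or.inr ⟨_, h, rfl⟩

theorem aux_indeg_pos {N : Graph} {u v : ℕ} (h : (u, v) ∈ N) : 1 ≤ indeg N v := by
  unfold indeg
  exact Multiset.card_pos_iff_exists_mem.2 ⟨(u, v), by simp [h]⟩

theorem aux_outdeg {N : Graph} {v : ℕ} (h : 1 ≤ outdeg N v) : ∃ z, (v, z) ∈ N := by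
  obtain ⟨⟨a, z⟩, h1⟩ := Multiset.card_pos_iff_exists_mem.1 h
  simp only [Multiset.mem_filter] at h1
  obtain ⟨h1, rfl⟩ := h1
  exact ⟨z, h1⟩

theorem aux_fst_internal (B : Shape) (e : ℕ × ℕ) (h : e ∈ B.edges) : e.1 ∈ B.internals := by
  cases B with
  | cherry a b p =>
    simp only [Shape.edges, Shape.internals, Finset.mem_insert, Finset.mem_singleton] at h ⊢
    rcases h with h | h <;> simp [h]
  | retic a b p q =>
    simp only [Shape.edges, Shape.internals, Finset.mem_insert, Finset.mem_singleton] at h ⊢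
    rcases h with h | h | h <;> simp [h]

theorem aux_leaf (N : Graph) (r : ℕ)
    (hN : IsNetwork N) (hr : IsRoot N r)
    (P : Finset Shape) (hP : IsCherryCover (bulged N) r P)
    (A : Shape) (hlow : IsLowest P A) (u v : ℕ) (huv : (u, v) ∈ N)
    (hv : v ∈ A.endpoints) (hv2 : v ∉ A.internals) : IsLeaf N v := by
  have hin := aux_indeg_pos huv
  have key : ¬ 1 ≤ outdeg N v := by
    intro ho
    obtain ⟨z, hz⟩ := aux_outdeg ho
    have hvr : v ≠ r := by
      rintro rfl
      have := hr.2.1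
      omega
    have hc := hP.2.1 (v, z) (aux_mem_bulged.2 hz) hvr
    obtain ⟨B, hB⟩ := Finset.card_pos.1 hc
    rw [Finset.mem_filter] at hB
    have hi := aux_fst_internal B _ hB.2
    refine hlow.2 B hB.1 ?_ (Relation.TransGen.single ⟨hlow.1, hB.1, v, hi, hv⟩)
    rintro rfl
    exact hv2 hi
  rcases hN.2.2.2 v (aux_snd_mem huv) with h | h | h | h
  · exact absurd h.2.2.ge key
  · exact h
  · exact absurd (le_trans (by norm_num) h.2.2) key
  · exact absurd h.2.2.ge key

/-- **Theorem (statement 17).** Let `P` be a cherry cover of `B(N)` and let `A` be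
a lowest shape of `P` with endpoints `x` and `y` whose edge `p_y y` has tail `p_y`
a tree vertex. Then `x` and `y` are leaves of `N` and `(x,y)` is a reducible pair
in `N`. -/
theorem lowest_shape_gives_reducible_pair (N : Graph) (r : ℕ)
    (hN : IsNetwork N) (hr : IsRoot N r)
    (P : Finset Shape) (hP : IsCherryCover (bulged N) r P)
    (A : Shape) (x y pY : ℕ) (hlow : IsLowest P A)
    (hA : A = Shape.cherry x y pY ∨ ∃ px, A = Shape.retic x y px pY)
    (hpY : IsTreeVertex N pY) :
    IsLeaf N x ∧ IsLeaf N y ∧ ReduciblePair N x y := by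
  have hval := hP.1 A hlow.1
  rcases hA with rfl | ⟨px, rfl⟩
  · simp only [Shape.valid, aux_mem_bulged] at hval
    obtain ⟨h1, h2, h3, h4, h5⟩ := hval
    have hx := aux_leaf N r hN hr P hP _ hlow pY x h4
      (by simp [Shape.endpoints]) (by simp [Shape.internals, h2])
    have hy := aux_leaf N r hN hr P hP _ hlow pY y h5
      (by simp [Shape.endpoints]) (by simp [Shape.internals, h3])
    exact ⟨hx, hy, Or.inl ⟨h1, hx, hy, pY, h4, h5⟩⟩
  · simp only [Shape.valid, aux_mem_bulged] at hval
    obtain ⟨h1, h2, h3, h4, h5, h6, h7, h8, h9, h10, h11⟩ := hval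
    have hx := aux_leaf N r hN hr P hP _ hlow px x h7
      (by simp [Shape.endpoints]) (by simp [Shape.internals, h2, h3])
    have hy := aux_leaf N r hN hr P hP _ hlow pY y h9
      (by simp [Shape.endpoints]) (by simp [Shape.internals, h4, h5])
    refine ⟨hx, hy, Or.inr ⟨h1, hx, hy, px, pY, ?_, h7, h8, h9⟩⟩
    have hin := aux_indeg_pos h8
    have hone : ¬ indeg N px = 1 := by
      intro h
      have hh := h
      unfold indeg at h
      obtain ⟨a, ha⟩ := Multiset.card_eq_one.1 h
      have hm : ∀ e ∈ N, e.2 = px → e = (pY, px) := by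
        have h' : ∀ e ∈ N, e.2 = px → e = a := by
          intro e he hp
          have : e ∈ Multiset.filter (fun e => e.2 = px) N := Multiset.mem_filter.2 ⟨he, hp⟩
          rw [ha] at this
          simpa using this
        intro e he hp
        rw [h' e he hp, h' _ h8 rfl]
      have : indeg (bulged N) px = indeg N px := by
        unfold indeg bulged
        congr 1
        apply aux_filter_bind
        intro e he hp
        rw [hm e he hp, if_neg]
        have := hpY.2.2
        rintro ⟨_, h⟩
        simp only at h
        omega
      omega
    rcases hN.2.2.2 px (aux_snd_mem h8) with h | h | h | h
    · exact absurd h.2.1 (by omega)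
    · exact absurd h.2.1 hone
    · exact absurd h.2.1 hone
    · exact h

end PhyloNet
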